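/- Let n = m·p be an odd positive integer with m, p ≥ 1. In S_n, let W be the subgroup generated by the p disjoint m-cycles c_i = ((i−1)m+1, (i−1)m+2, …, im) for 1 ≤ i ≤ p, together with the block-shift permutation β defined by β((i−1)m + j) = (i mod p)·m + j for 1 ≤ i ≤ p, 1 ≤ j ≤ m (so W is a copy of the wreath product C_m ≀ C_p inside S_n). Then there exists a subgroup K of Schur's double cover S̃_n such that the projection π : S̃_n → S_n restricts to an injective homomorphism on K with π(K) = W; in particular K is isomorphic to C_m ≀ C_p. -/

import Mathlib

/-!
Schur's double cover `S̃_N` of the symmetric group, presented by generators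
`z, t_1, …, t_{N-1}` and relations `z² = 1`, `t_i² = z`, `(t_i t_{i+1})³ = z`,
`(t_i t_j)² = z` for `|i − j| ≥ 2`.

Generators are indexed by `Option (Fin (N-1))`: `none` is the central element `z`
and `some i` is `t_{i+1}` (so `some i` for `i = 0, …, N-2` are `t_1, …, t_{N-1}`).
-/

abbrev SchurGen (N : ℕ) := Option (Fin (N - 1))

namespace Schur

/-- The relator `z` as an element of the free group. -/
def zf (N : ℕ) : FreeGroup (SchurGen N) := FreeGroup.of none

/-- The generator `t_{i+1}` as an element of the free group. -/
def tf (N : ℕ) (i : Fin (N - 1)) : FreeGroup (SchurGen N) := FreeGroup.of (some i)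

/-- The defining relators of Schur's double cover. -/
def rels (N : ℕ) : Set (FreeGroup (SchurGen N)) :=
  { r | r = zf N ^ 2 ∨
        (∃ i, r = tf N i ^ 2 * (zf N)⁻¹) ∨
        (∃ i j : Fin (N - 1), (i : ℕ) + 1 = (j : ℕ) ∧
          r = (tf N i * tf N j) ^ 3 * (zf N)⁻¹) ∨
        (∃ i j : Fin (N - 1), ((i : ℕ) + 2 ≤ (j : ℕ) ∨ (j : ℕ) + 2 ≤ (i : ℕ)) ∧
          r = (tf N i * tf N j) ^ 2 * (zf N)⁻¹) }

/-- Schur's double cover `S̃_N` of the symmetric group `S_N`. -/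
abbrev Cover (N : ℕ) := PresentedGroup (rels N)

/-- The central element `z` of `S̃_N`. -/
def z (N : ℕ) : Cover N := PresentedGroup.of none

/-- The generator `t_{i+1}` of `S̃_N` (0-indexed). -/
def t (N : ℕ) (i : Fin (N - 1)) : Cover N := PresentedGroup.of (some i)

/-- The generator `t_i` of `S̃_N`, 1-indexed: meaningful for `1 ≤ i ≤ N-1`
(junk value `1` outside this range). -/
def T (N i : ℕ) : Cover N := if h : i - 1 < N - 1 then t N ⟨i - 1, h⟩ else 1

/-- The product `t_a t_{a+1} ⋯ t_{a+n-1}` (`n` consecutive generators, 1-indexed). -/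
def P (N a n : ℕ) : Cover N := ((List.range n).map fun j => T N (a + j)).prod

end Schur


/-- The adjacent transposition `(i, i+1)` of `{1, …, n}`: in 0-indexed terms, for
`i : Fin (n-1)` this is the swap of `i` and `i+1` in `Fin n`.  It is the image of the
generator `t_{i+1}` under the canonical projection `S̃_n → S_n`. -/
def Schur.adj (n : ℕ) (i : Fin (n - 1)) : Equiv.Perm (Fin n) :=
  Equiv.swap ⟨i.1, by have := i.2; omega⟩ ⟨i.1 + 1, by have := i.2; omega⟩

namespace Schur

section CoxeterRelations

variable {G : Type*} [Group G] {M : ℕ} {s : Fin M → G}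

/-- The subgroup generated by the generators of index less than `k`. -/
def parabolic (s : Fin M → G) (k : ℕ) : Subgroup G :=
  Subgroup.closure {g | ∃ i : Fin M, (i : ℕ) < k ∧ s i = g}

lemma parabolic_mono (s : Fin M → G) {k l : ℕ} (h : k ≤ l) : parabolic s k ≤ parabolic s l :=
  Subgroup.closure_mono fun _ ⟨i, hi, hg⟩ => ⟨i, hi.trans_le h, hg⟩

lemma mem_parabolic (s : Fin M → G) {i : Fin M} {k : ℕ} (h : (i : ℕ) < k) :
    s i ∈ parabolic s k :=
  Subgroup.subset_closure ⟨i, h, rfl⟩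

lemma commute_of_mem_parabolic (hsq : ∀ i, s i ^ 2 = 1)
    (hcomm : ∀ i j : Fin M, (i : ℕ) + 2 ≤ j → (s i * s j) ^ 2 = 1)
    {k : ℕ} {j : Fin M} (hj : k + 1 ≤ j) {x : G} (hx : x ∈ parabolic s k) :
    Commute (s j) x := by
  have hle : parabolic s k ≤ Subgroup.centralizer {s j} := by
    refine (Subgroup.closure_le _).2 ?_
    rintro _ ⟨i, hi, rfl⟩
    rw [SetLike.mem_coe, Subgroup.mem_centralizer_singleton_iff]
    have h := hcomm i j (by omega)
    have hi' : (s i)⁻¹ = s i := inv_eq_of_mul_eq_one_left (by rw [← pow_two, hsq])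
    have hj' : (s j)⁻¹ = s j := inv_eq_of_mul_eq_one_left (by rw [← pow_two, hsq])
    rw [pow_two, mul_eq_one_iff_eq_inv, mul_inv_rev, hi', hj'] at h
    exact h
  have := hle hx
  rw [Subgroup.mem_centralizer_singleton_iff] at this
  exact this.symm

lemma braid_eq (hsq : ∀ i, s i ^ 2 = 1) {i j : Fin M} (h : (s i * s j) ^ 3 = 1) :
    s j * s i * s j = s i * s j * s i := by
  have hi' : (s i)⁻¹ = s i := inv_eq_of_mul_eq_one_left (by rw [← pow_two, hsq])
  have hj' : (s j)⁻¹ = s j := inv_eq_of_mul_eq_one_left (by rw [← pow_two, hsq])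
  have h' : (s i * s j * s i) * (s j * s i * s j) = 1 := by
    rw [← h, pow_succ, pow_two]; group
  rw [mul_eq_one_iff_eq_inv] at h'
  rw [h']
  simp [hi', hj', mul_assoc]

/-- Double coset decomposition of a parabolic subgroup by the preceding one. -/
lemma mem_parabolic_succ (hsq : ∀ i, s i ^ 2 = 1)
    (hbraid : ∀ i j : Fin M, (i : ℕ) + 1 = j → (s i * s j) ^ 3 = 1)
    (hcomm : ∀ i j : Fin M, (i : ℕ) + 2 ≤ j → (s i * s j) ^ 2 = 1)
    (k : ℕ) (hk : k < M) {x : G} (hx : x ∈ parabolic s (k + 1)) :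
    x ∈ parabolic s k ∨
      ∃ a ∈ parabolic s k, ∃ b ∈ parabolic s k, x = a * s ⟨k, hk⟩ * b := by
  induction k generalizing x with
  | zero =>
    have hss : s ⟨0, hk⟩ * s ⟨0, hk⟩ = 1 := by rw [← pow_two, hsq]
    have key : x = 1 ∨ x = s ⟨0, hk⟩ := by
      refine Subgroup.closure_induction ?_ (Or.inl rfl) ?_ ?_ hx
      · rintro _ ⟨i, hi, rfl⟩
        right; congr 1; ext; simpa using hi
      · rintro x y - - (rfl | rfl) (rfl | rfl) <;> simp [hss]
      · rintro x - (rfl | rfl)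
        · simp
        · exact Or.inr (inv_eq_of_mul_eq_one_left hss)
    rcases key with rfl | rfl
    · exact Or.inl (one_mem _)
    · exact Or.inr ⟨1, one_mem _, 1, one_mem _, by simp⟩
  | succ k ih =>
    have hk' : k < M := by omega
    set u := s ⟨k, hk'⟩ with hu
    set v := s ⟨k + 1, hk⟩ with hv
    have hvv : v * v = 1 := by rw [← pow_two, hsq]
    have hvinv : v⁻¹ = v := inv_eq_of_mul_eq_one_left hvv
    have hmem : u ∈ parabolic s (k + 1) := mem_parabolic s (by simp)
    have hle : parabolic s k ≤ parabolic s (k + 1) := parabolic_mono s (by omega)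
    have hbr : v * u * v = u * v * u := braid_eq hsq (hbraid _ _ rfl)
    have hcm : ∀ a ∈ parabolic s k, Commute v a := fun a ha =>
      commute_of_mem_parabolic hsq hcomm (j := ⟨k + 1, hk⟩) le_rfl ha
    have conj : ∀ h ∈ parabolic s (k + 1), v * h * v ∈ parabolic s (k + 1) ∨
        ∃ a ∈ parabolic s (k + 1), ∃ b ∈ parabolic s (k + 1), v * h * v = a * v * b := by
      intro h hh
      rcases ih hk' hh with hh | ⟨a, ha, b, hb, rfl⟩
      · left
        rw [(hcm h hh).eq, mul_assoc, hvv, mul_one]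
        exact hle hh
      · right
        refine ⟨a * u, mul_mem (hle ha) hmem, u * b, mul_mem hmem (hle hb), ?_⟩
        calc v * (a * u * b) * v = (v * a) * u * (b * v) := by group
          _ = (a * v) * u * (v * b) := by rw [(hcm a ha).eq, (hcm b hb).eq]
          _ = a * (v * u * v) * b := by group
          _ = a * u * v * (u * b) := by rw [hbr]; group
    refine Subgroup.closure_induction ?_ (Or.inl (one_mem _)) ?_ ?_ hx
    · rintro _ ⟨i, hi, rfl⟩
      rcases Nat.lt_succ_iff_lt_or_eq.1 hi with hi | hi
      · exact Or.inl (mem_parabolic s hi)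
      · refine Or.inr ⟨1, one_mem _, 1, one_mem _, ?_⟩
        rw [one_mul, mul_one, hv]; congr 1; ext; exact hi
    · rintro x y - - (hx | ⟨a, ha, b, hb, rfl⟩) (hy | ⟨c, hc, d, hd, rfl⟩)
      · exact Or.inl (mul_mem hx hy)
      · exact Or.inr ⟨x * c, mul_mem hx hc, d, hd, by group⟩
      · exact Or.inr ⟨a, ha, b * y, mul_mem hb hy, by group⟩
      · have e : a * v * b * (c * v * d) = a * (v * (b * c) * v) * d := by group
        rcases conj _ (mul_mem hb hc) with h | ⟨a', ha', b', hb', h⟩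
        · left; rw [e]; exact mul_mem (mul_mem ha h) hd
        · right
          exact ⟨a * a', mul_mem ha ha', b' * d, mul_mem hb' hd, by rw [e, h]; group⟩
    · rintro x - (hx | ⟨a, ha, b, hb, rfl⟩)
      · exact Or.inl (inv_mem hx)
      · exact Or.inr ⟨b⁻¹, inv_mem hb, a⁻¹, inv_mem ha, by simp [hvinv, mul_assoc]⟩

end CoxeterRelations

/-- The Coxeter relations present the symmetric group: a group generated by elements satisfying
them maps injectively when these elements go to the adjacent transpositions. -/
lemma injective_of_coxeter_relations {G : Type*} [Group G] {n : ℕ} {s : Fin (n - 1) → G}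
    (hsq : ∀ i, s i ^ 2 = 1)
    (hbraid : ∀ i j : Fin (n - 1), (i : ℕ) + 1 = j → (s i * s j) ^ 3 = 1)
    (hcomm : ∀ i j : Fin (n - 1), (i : ℕ) + 2 ≤ j → (s i * s j) ^ 2 = 1)
    (hgen : Subgroup.closure (Set.range s) = ⊤)
    (ρ : G →* Equiv.Perm (Fin n)) (hρ : ∀ i, ρ (s i) = adj n i) :
    Function.Injective ρ := by
  have fixes : ∀ (k : ℕ) (y : Fin n), k < y → ∀ g ∈ parabolic s k, ρ g y = y := by
    intro k y hy g hg
    have hle : parabolic s k ≤ (MulAction.stabilizer (Equiv.Perm (Fin n)) y).comap ρ := by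
      refine (Subgroup.closure_le _).2 ?_
      rintro _ ⟨i, hi, rfl⟩
      change ρ (s i) y = y
      rw [hρ, adj]
      apply Equiv.swap_apply_of_ne_of_ne <;> simp only [ne_eq, Fin.ext_iff] <;> omega
    exact hle hg
  have key : ∀ k ≤ n - 1, ∀ g ∈ parabolic s k, ρ g = 1 → g = 1 := by
    intro k
    induction k with
    | zero => intro _ g hg _; simpa [parabolic] using hg
    | succ k ih =>
      intro hk g hg h1
      rcases mem_parabolic_succ hsq hbraid hcomm k hk hg with hg | ⟨a, ha, b, hb, rfl⟩
      · exact ih (by omega) g hg h1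
      · exfalso
        set y : Fin n := ⟨k + 1, by omega⟩
        have h2 : ρ (s ⟨k, hk⟩) = ρ (a⁻¹ * b⁻¹) := by
          have : s ⟨k, hk⟩ = a⁻¹ * (a * s ⟨k, hk⟩ * b) * b⁻¹ := by group
          rw [this, map_mul, map_mul, h1, mul_one, map_mul]
        have h3 := fixes k y (by simp [y]) _ (mul_mem (inv_mem ha) (inv_mem hb))
        rw [← h2, hρ, adj, Equiv.swap_apply_right] at h3
        simp [y] at h3
  refine (injective_iff_map_eq_one ρ).2 fun g hg => key (n - 1) le_rfl g ?_ hg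
  have : parabolic s (n - 1) = ⊤ := by
    rw [← hgen, parabolic]
    congr 1
    ext g
    simp
  simp [this]

section Cover

variable (n : ℕ)

lemma z_sq : z n ^ 2 = 1 :=
  PresentedGroup.one_of_mem (Or.inl rfl : zf n ^ 2 ∈ rels n)

lemma t_sq (i : Fin (n - 1)) : t n i ^ 2 = z n :=
  mul_inv_eq_one.1 <|
    PresentedGroup.one_of_mem (Or.inr (Or.inl ⟨i, rfl⟩) : tf n i ^ 2 * (zf n)⁻¹ ∈ rels n)

lemma t_braid (i j : Fin (n - 1)) (h : (i : ℕ) + 1 = j) : (t n i * t n j) ^ 3 = z n :=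
  mul_inv_eq_one.1 <| PresentedGroup.one_of_mem
    (Or.inr (Or.inr (Or.inl ⟨i, j, h, rfl⟩)) : (tf n i * tf n j) ^ 3 * (zf n)⁻¹ ∈ rels n)

lemma t_comm (i j : Fin (n - 1)) (h : (i : ℕ) + 2 ≤ j) : (t n i * t n j) ^ 2 = z n :=
  mul_inv_eq_one.1 <| PresentedGroup.one_of_mem
    (Or.inr (Or.inr (Or.inr ⟨i, j, Or.inl h, rfl⟩)) : (tf n i * tf n j) ^ 2 * (zf n)⁻¹ ∈ rels n)

lemma z_mem_center : z n ∈ Subgroup.center (Cover n) := by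
  have h : (⊤ : Subgroup (Cover n)) ≤ Subgroup.centralizer {z n} := by
    rw [← PresentedGroup.closure_range_of, Subgroup.closure_le]
    rintro _ ⟨_ | i, rfl⟩ <;> rw [SetLike.mem_coe, Subgroup.mem_centralizer_singleton_iff]
    · rfl
    · change t n i * z n = z n * t n i
      rw [← t_sq n i, pow_two, mul_assoc]
  rw [Subgroup.mem_center_iff]
  intro g
  have := h (Subgroup.mem_top g)
  rw [Subgroup.mem_centralizer_singleton_iff] at this
  exact this

instance normal_zpowers_z : (Subgroup.zpowers (z n)).Normal :=
  ⟨fun x hx g => by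
    have hc : x ∈ Subgroup.center (Cover n) :=
      (Subgroup.zpowers_le.2 (z_mem_center n)) hx
    rwa [Subgroup.mem_center_iff.1 hc g, mul_inv_cancel_right]⟩

variable {n}

lemma ker_le_zpowers_z {π : Cover n →* Equiv.Perm (Fin n)}
    (hπt : ∀ i : Fin (n - 1), π (t n i) = adj n i) (hπz : π (z n) = 1) :
    π.ker ≤ Subgroup.zpowers (z n) := by
  set q := QuotientGroup.mk' (Subgroup.zpowers (z n))
  have hz : q (z n) = 1 := (QuotientGroup.eq_one_iff _).2 (Subgroup.mem_zpowers _)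
  have hle : Subgroup.zpowers (z n) ≤ π.ker := by simpa using hπz
  have hgen : Subgroup.closure (Set.range fun i => q (t n i)) = ⊤ := by
    rw [← top_le_iff, ← (MonoidHom.range_eq_top.2 (QuotientGroup.mk'_surjective _) : q.range = ⊤),
      MonoidHom.range_eq_map, ← PresentedGroup.closure_range_of, MonoidHom.map_closure,
      Subgroup.closure_le]
    rintro _ ⟨_, ⟨_ | i, rfl⟩, rfl⟩
    · change q (z n) ∈ _
      rw [hz]; exact one_mem _
    · exact Subgroup.subset_closure ⟨i, rfl⟩
  have hinj := injective_of_coxeter_relations (s := fun i => q (t n i))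
    (fun i => by rw [← map_pow, t_sq, hz])
    (fun i j h => by rw [← map_mul, ← map_pow, t_braid n i j h, hz])
    (fun i j h => by rw [← map_mul, ← map_pow, t_comm n i j h, hz])
    hgen (QuotientGroup.lift _ π hle) hπt
  intro x hx
  rw [← QuotientGroup.eq_one_iff]
  apply hinj
  rw [map_one]
  exact hx

lemma card_ker_dvd_two {π : Cover n →* Equiv.Perm (Fin n)}
    (hπt : ∀ i : Fin (n - 1), π (t n i) = adj n i) (hπz : π (z n) = 1) :
    Nat.card π.ker ∣ 2 :=
  (Subgroup.card_dvd_of_le (ker_le_zpowers_z hπt hπz)).trans <| by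
    rw [Nat.card_zpowers]; exact orderOf_dvd_of_pow_eq_one (z_sq n)

lemma surjective_of_map_t {π : Cover n →* Equiv.Perm (Fin n)}
    (hπt : ∀ i : Fin (n - 1), π (t n i) = adj n i) : Function.Surjective π := by
  rcases n with _ | n
  · exact fun σ => ⟨1, Subsingleton.elim _ _⟩
  · rw [← MonoidHom.range_eq_top, ← top_le_iff]
    intro σ _
    have hσ : σ ∈ Submonoid.closure
        (Set.range fun i : Fin n ↦ Equiv.swap i.castSucc i.succ) := by
      rw [Equiv.Perm.mclosure_swap_castSucc_succ]; trivial
    have hle : Submonoid.closure (Set.range fun i : Fin n ↦ Equiv.swap i.castSucc i.succ) ≤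
        π.range.toSubmonoid := by
      rw [Submonoid.closure_le]
      rintro _ ⟨i, rfl⟩
      exact ⟨t (n + 1) i, hπt i⟩
    exact hle hσ

end Cover

/-- A subgroup of the target of order coprime to the kernel lifts, by Schur–Zassenhaus. -/
lemma exists_lift_of_coprime {G H : Type*} [Group G] [Group H] {f : G →* H}
    (hf : Function.Surjective f) (W : Subgroup H)
    (hcop : (Nat.card f.ker).Coprime (Nat.card W)) :
    ∃ K : Subgroup G, Function.Injective (fun x : K => f (x : G)) ∧ K.map f = W := by
  set g := f.subgroupComap W
  have hg : Function.Surjective g := f.subgroupComap_surjective_of_surjective W hf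
  have hker : Nat.card g.ker ∣ Nat.card f.ker := by
    rw [← Subgroup.card_subtype (W.comap f) g.ker]
    refine Subgroup.card_dvd_of_le ?_
    rintro _ ⟨x, hx, rfl⟩
    exact congrArg Subtype.val hx
  have hcard : g.ker.index = Nat.card W := by
    rw [Subgroup.index_ker, MonoidHom.range_eq_top.2 hg, Subgroup.card_top]
  obtain ⟨L, hL⟩ := Subgroup.exists_right_complement'_of_coprime (N := g.ker)
    (by rw [hcard]; exact hcop.coprime_dvd_left hker)
  refine ⟨L.map (W.comap f).subtype, ?_, ?_⟩
  · rintro ⟨_, x, hx, rfl⟩ ⟨_, y, hy, rfl⟩ hxy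
    have h1 : x⁻¹ * y ∈ g.ker ⊓ L := by
      refine Subgroup.mem_inf.2 ⟨?_, mul_mem (inv_mem hx) hy⟩
      rw [MonoidHom.mem_ker, map_mul, map_inv, inv_mul_eq_one]
      exact Subtype.ext hxy
    rw [hL.disjoint.eq_bot, Subgroup.mem_bot, inv_mul_eq_one] at h1
    simp [h1]
  · have hmap : L.map g = ⊤ := by
      have h := congrArg (Subgroup.map g) hL.sup_eq_top
      rwa [Subgroup.map_sup, (Subgroup.map_eq_bot_iff _).2 le_rfl, bot_sup_eq,
        ← MonoidHom.range_eq_map, MonoidHom.range_eq_top.2 hg] at h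
    rw [Subgroup.map_map]
    have : f.comp (W.comap f).subtype = W.subtype.comp g := rfl
    rw [this, ← Subgroup.map_map, hmap, ← MonoidHom.range_eq_map, Subgroup.range_subtype]

/-- The permutations which, in the coordinates `e`, translate the block index by a constant and
each block by an amount depending on the block. -/
def wreathSubgroup {α A B : Type*} [AddCommGroup A] [AddCommGroup B] (e : α → A × B) :
    Subgroup (Equiv.Perm α) where
  carrier := {σ | ∃ (r : A) (φ : A → B),
    ∀ x, e (σ x) = ((e x).1 + r, (e x).2 + φ (e x).1)}
  one_mem' := ⟨0, 0, by simp⟩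
  mul_mem' := by
    rintro σ τ ⟨r, φ, h⟩ ⟨r', φ', h'⟩
    refine ⟨r' + r, fun a => φ' a + φ (a + r'), fun x => ?_⟩
    simp [h, h', add_assoc]
  inv_mem' := by
    rintro σ ⟨r, φ, h⟩
    refine ⟨-r, fun a => -φ (a - r), fun x => ?_⟩
    obtain ⟨y, rfl⟩ := σ.surjective x
    simp [h]

lemma eq_one_of_mem_wreathSubgroup {α A B : Type*} [AddCommGroup A] [AddCommGroup B]
    {e : α → A × B} (he : Function.Injective e) (hA : ∀ a : A, a + a = 0 → a = 0)
    (hB : ∀ b : B, b + b = 0 → b = 0) {σ : Equiv.Perm α} (hσ : σ ∈ wreathSubgroup e)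
    (h2 : σ ^ 2 = 1) : σ = 1 := by
  obtain ⟨r, φ, h⟩ := hσ
  ext1 x
  have hx : σ (σ x) = x := by
    rw [← Equiv.Perm.mul_apply, ← pow_two, h2, Equiv.Perm.one_apply]
  have hex := congrArg e hx
  rw [h, h, Prod.ext_iff] at hex
  obtain ⟨h₁, h₂⟩ := hex
  have hr : r = 0 := hA r (by simpa [add_assoc] using h₁)
  have hφ : φ (e x).1 = 0 := hB _ (by simpa [add_assoc, hr] using h₂)
  apply he
  simp [h, hr, hφ]

lemma odd_card_of_forall_sq {G : Type*} [Group G] [Finite G]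
    (h : ∀ g : G, g ^ 2 = 1 → g = 1) : Odd (Nat.card G) := by
  rw [← Nat.not_even_iff_odd, even_iff_two_dvd]
  intro hd
  obtain ⟨g, hg⟩ := exists_prime_orderOf_dvd_card' 2 hd
  have := h g (hg ▸ pow_orderOf_eq_one g)
  simp [this] at hg

lemma zmod_eq_zero_of_add_self {k : ℕ} (hk : Odd k) (a : ZMod k) (h : a + a = 0) :
    a = 0 := by
  have hu : IsUnit ((2 : ℕ) : ZMod k) :=
    (ZMod.isUnit_iff_coprime 2 k).2 (Nat.coprime_two_left.2 hk)
  rw [← hu.mul_right_eq_zero, Nat.cast_two, two_mul, h]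

/-- Coordinates of a point: its block and its position in the block. -/
def blockCoord (m p : ℕ) {n : ℕ} (x : Fin n) : ZMod p × ZMod m :=
  (((x : ℕ) / m : ℕ), (x : ℕ))

lemma blockCoord_injective {n m p : ℕ} (hn : n = m * p) :
    Function.Injective (blockCoord m p : Fin n → ZMod p × ZMod m) := by
  intro x y h
  obtain ⟨h₁, h₂⟩ := Prod.ext_iff.1 h
  simp only [blockCoord, ZMod.natCast_eq_natCast_iff, Nat.ModEq] at h₁ h₂
  rw [Nat.mod_eq_of_lt (Nat.div_lt_of_lt_mul (hn ▸ x.2)),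
    Nat.mod_eq_of_lt (Nat.div_lt_of_lt_mul (hn ▸ y.2))] at h₁
  ext
  rw [← Nat.div_add_mod (x : ℕ) m, ← Nat.div_add_mod (y : ℕ) m, h₁, h₂]

lemma blockCoord_of_val_eq {n m p : ℕ} {x : Fin n} {a b : ℕ} (hb : b < m)
    (hx : (x : ℕ) = a * m + b) : blockCoord m p x = ((a : ZMod p), (b : ZMod m)) := by
  have : (a * m + b) / m = a := by
    rw [add_comm, Nat.add_mul_div_right _ _ (by omega), Nat.div_eq_of_lt hb, zero_add]
  simp [blockCoord, hx, this]

end Schur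

open Schur in
/-- Lemma: for `n = m·p` odd, the natural copy `W = ⟨c_1, …, c_p, β⟩ ≅ C_m ≀ C_p` of the
wreath product inside `S_n` (generated by the `p` disjoint `m`-cycles `c_i` on the blocks
of size `m`, together with the block shift `β`) lifts to an isomorphic subgroup of
Schur's double cover `S̃_n`: there is `K ≤ S̃_n` on which the projection `π` is injective
with `π(K) = W`.  (All points are 0-indexed: `c i` cyclically shifts the block
`{im, …, im+m-1}` and `β` sends the `b`-th block to the `(b+1 mod p)`-th block.) -/
theorem schur_wreath_product_lifts (n m p : ℕ) (hm : 1 ≤ m) (hp : 1 ≤ p)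
    (hn : n = m * p) (hodd : Odd n)
    (π : Cover n →* Equiv.Perm (Fin n))
    (hπt : ∀ i : Fin (n - 1), π (t n i) = adj n i)
    (hπz : π (z n) = 1)
    (c : Fin p → Equiv.Perm (Fin n))
    (hc : ∀ (i : Fin p) (x : Fin n), ((c i x : Fin n) : ℕ) =
      if (x : ℕ) / m = (i : ℕ) then (i : ℕ) * m + (((x : ℕ) % m + 1) % m) else (x : ℕ))
    (β : Equiv.Perm (Fin n))
    (hβ : ∀ x : Fin n, ((β x : Fin n) : ℕ) = (((x : ℕ) / m + 1) % p) * m + (x : ℕ) % m) :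
    ∃ K : Subgroup (Cover n),
      Function.Injective (fun x : K => π (x : Cover n)) ∧
      Subgroup.map π K = Subgroup.closure (Set.range c ∪ {β}) := by
  have hmodd : Odd m := (Nat.odd_mul.1 (hn ▸ hodd)).1
  have hpodd : Odd p := (Nat.odd_mul.1 (hn ▸ hodd)).2
  have hle : Subgroup.closure (Set.range c ∪ {β}) ≤ wreathSubgroup (blockCoord m p) := by
    rw [Subgroup.closure_le]
    rintro _ (⟨i, rfl⟩ | rfl)
    · refine ⟨0, Pi.single ((i : ℕ) : ZMod p) 1, fun x => ?_⟩
      have hxc : blockCoord m p x =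
          ((((x : ℕ) / m : ℕ) : ZMod p), ((x : ℕ) : ZMod m)) := rfl
      have hxp : (x : ℕ) / m < p := Nat.div_lt_of_lt_mul (hn ▸ x.2)
      have h := hc i x
      split_ifs at h with hxi
      · rw [blockCoord_of_val_eq (Nat.mod_lt _ hm) h, hxc, hxi]
        simp
      · have hne : (((x : ℕ) / m : ℕ) : ZMod p) ≠ ((i : ℕ) : ZMod p) := by
          rwa [Ne, ZMod.natCast_eq_natCast_iff, Nat.ModEq, Nat.mod_eq_of_lt hxp,
            Nat.mod_eq_of_lt i.2]
        rw [Fin.ext h, hxc]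
        simp [Pi.single_eq_of_ne hne]
    · refine ⟨1, 0, fun x => ?_⟩
      rw [blockCoord_of_val_eq (Nat.mod_lt _ hm) (hβ x)]
      simp [blockCoord]
  have hWodd : Odd (Nat.card (Subgroup.closure (Set.range c ∪ {β}))) :=
    odd_card_of_forall_sq fun g hg => Subtype.ext <|
      eq_one_of_mem_wreathSubgroup (blockCoord_injective hn)
        (zmod_eq_zero_of_add_self hpodd) (zmod_eq_zero_of_add_self hmodd)
        (hle g.2) (congrArg Subtype.val hg)
  exact exists_lift_of_coprime (surjective_of_map_t hπt) _
    ((Nat.coprime_two_left.2 hWodd).coprime_dvd_left (card_ker_dvd_two hπt hπz))
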